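/- arXiv:1511.07480 — 5 statements merged into one kernel-verified Lean document; each statement's English description precedes it below -/
import Mathlib

section
/- For every k ≥ 3, there exists an unweighted graph H with at most C·k vertices and edges (for an absolute constant C) and k distinct distinguished vertices u₁,…,u_k such that for every subset S ⊆ {1,…,k}, the number of perfect matchings of the induced subgraph H − {u_i : i ∈ S} equals 1 if |S| is even and 0 if |S| is odd. That is, H is an unweighted matchgate realizing the signature EVEN_k. -/
open scoped Classical

/-- The number of perfect matchings of an unweighted (simple) graph. -/
noncomputable def numPM {α : Type} (G : SimpleGraph α) : ℕ :=
  Nat.card {M : G.Subgraph // M.IsPerfectMatching}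

theorem em_count {α : Type} [LinearOrder α] (G : SimpleGraph α) (n : ℕ) (e : Fin n ≃o α)
    (hpath : ∀ a b : α, a ⋖ b → G.Adj a b)
    (hchord : ∀ a b : α, G.Adj a b → a < b → ¬ a ⋖ b →
      ∃ z, z ≠ a ∧ z ≠ b ∧ ∀ w, G.Adj z w → w = a ∨ w = b) :
    numPM G = if Even n then 1 else 0 := by
  -- every edge of a perfect matching joins consecutive vertices
  have hcov : ∀ M : G.Subgraph, M.IsPerfectMatching → ∀ a b, M.Adj a b → a < b → a ⋖ b := by
    intro M hM a b hab hlt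
    by_contra hc
    obtain ⟨z, hza, hzb, hz⟩ := hchord a b hab.adj_sub hlt hc
    obtain ⟨w, hw, -⟩ := hM.1 (hM.2 z)
    rcases hz w hw.adj_sub with rfl | rfl
    · exact hzb (hM.1.eq_of_adj_left hw.symm hab)
    · exact hza (hM.1.eq_of_adj_left hw.symm hab.symm)
  have hcons : ∀ M : G.Subgraph, M.IsPerfectMatching → ∀ i j : Fin n, M.Adj (e i) (e j) →
      i.val + 1 = j.val ∨ j.val + 1 = i.val := by
    intro M hM i j h
    rcases lt_trichotomy (e i) (e j) with hl | hl | hl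
    · left
      have := hcov M hM _ _ h hl
      rw [apply_covBy_apply_iff] at this
      simpa using this
    · exact absurd (hl ▸ h.adj_sub) (G.loopless.irrefl _)
    · right
      have := hcov M hM _ _ h.symm hl
      rw [apply_covBy_apply_iff] at this
      simpa using this
  have hnext : ∀ M : G.Subgraph, M.IsPerfectMatching → ∀ m : ℕ, ∀ i : Fin n, i.val = 2 * m →
      ∃ j : Fin n, j.val = 2 * m + 1 ∧ M.Adj (e i) (e j) := by
    intro M hM m
    induction m with
    | zero =>
      intro i hi
      obtain ⟨w, hw, -⟩ := hM.1 (hM.2 (e i))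
      obtain ⟨j, rfl⟩ := e.surjective w
      refine ⟨j, ?_, hw⟩
      have := hcons M hM _ _ hw
      omega
    | succ m ih =>
      intro i hi
      obtain ⟨w, hw, -⟩ := hM.1 (hM.2 (e i))
      obtain ⟨j, rfl⟩ := e.surjective w
      refine ⟨j, ?_, hw⟩
      have h1 := hcons M hM _ _ hw
      rcases h1 with h1 | h1
      · omega
      · exfalso
        obtain ⟨j', hj', ha⟩ := ih ⟨2 * m, by omega⟩ rfl
        have : j' = j := Fin.ext (by omega)
        subst this
        have h2 := hM.1.eq_of_adj_left hw.symm ha.symm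
        have h3 := congrArg Fin.val (e.injective h2)
        simp at h3
        omega
  split_ifs with hn
  · unfold numPM
    rw [Nat.card_eq_one_iff_unique]
    have hadj : ∀ M : G.Subgraph, M.IsPerfectMatching → ∀ i j : Fin n, M.Adj (e i) (e j) ↔
      ((i.val % 2 = 0 ∧ i.val + 1 = j.val) ∨ (j.val % 2 = 0 ∧ j.val + 1 = i.val)) := by
      have key : ∀ M : G.Subgraph, M.IsPerfectMatching → ∀ i j : Fin n,
          i.val % 2 = 0 → i.val + 1 = j.val → M.Adj (e i) (e j) := by
        intro M hM i j h1 h2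
        obtain ⟨j', hj', ha⟩ := hnext M hM (i.val / 2) i (by omega)
        have : j' = j := Fin.ext (by omega)
        exact this ▸ ha
      have key2 : ∀ M : G.Subgraph, M.IsPerfectMatching → ∀ i j : Fin n,
          i.val + 1 = j.val → M.Adj (e i) (e j) → i.val % 2 = 0 := by
        intro M hM i j h1 h
        by_contra hc
        have h2 := key M hM ⟨i.val - 1, by omega⟩ i (by simp; omega) (by simp; omega)
        have h3 := hM.1.eq_of_adj_left h h2.symm
        have h4 := congrArg Fin.val (e.injective h3)
        simp at h4
        omega
      intro M hM i j
      constructor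
      · intro h
        rcases hcons M hM i j h with h1 | h1
        · exact Or.inl ⟨key2 M hM _ _ h1 h, h1⟩
        · exact Or.inr ⟨key2 M hM _ _ h1 h.symm, h1⟩
      · rintro (⟨h1, h2⟩ | ⟨h1, h2⟩)
        · exact key M hM _ _ h1 h2
        · exact (key M hM _ _ h1 h2).symm
    constructor
    · constructor
      rintro ⟨M, hM⟩ ⟨M', hM'⟩
      apply Subtype.ext
      apply SimpleGraph.Subgraph.ext
      · rw [hM.2.verts_eq_univ, hM'.2.verts_eq_univ]
      · funext a b
        obtain ⟨i, rfl⟩ := e.surjective a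
        obtain ⟨j, rfl⟩ := e.surjective b
        exact propext ((hadj M hM i j).trans (hadj M' hM' i j).symm)
    · have hG : ∀ i j : Fin n, i.val + 1 = j.val → G.Adj (e i) (e j) := by
        intro i j h
        apply hpath
        rw [apply_covBy_apply_iff]
        simpa using h
      let R : Fin n → Fin n → Prop := fun i j =>
        ((i.val % 2 = 0 ∧ i.val + 1 = j.val) ∨ (j.val % 2 = 0 ∧ j.val + 1 = i.val))
      let M : G.Subgraph :=
        { verts := Set.univ
          Adj := fun a b => R (e.symm a) (e.symm b)
          adj_sub := by
            intro a b h
            obtain ⟨i, rfl⟩ := e.surjective a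
            obtain ⟨j, rfl⟩ := e.surjective b
            simp only [OrderIso.symm_apply_apply] at h
            rcases h with ⟨_, h⟩ | ⟨_, h⟩
            · exact hG _ _ h
            · exact (hG _ _ h).symm
          edge_vert := fun _ => Set.mem_univ _
          symm := ⟨fun a b h => Or.symm h⟩ }
      refine ⟨⟨M, ?_, fun v => Set.mem_univ v⟩⟩
      intro v _
      obtain ⟨i, rfl⟩ := e.surjective v
      have hi := i.isLt
      have h2 : n % 2 = 0 := Nat.even_iff.1 hn
      rcases Nat.mod_two_eq_zero_or_one i.val with h | h
      · refine ⟨e ⟨i.val + 1, by omega⟩, ?_, ?_⟩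
        · change R _ _
          simp [R, h]
        · intro y hy
          obtain ⟨j, rfl⟩ := e.surjective y
          change R _ _ at hy
          simp only [R, OrderIso.symm_apply_apply] at hy
          congr 1
          apply Fin.ext
          simp
          omega
      · refine ⟨e ⟨i.val - 1, by omega⟩, ?_, ?_⟩
        · change R _ _
          simp only [R, OrderIso.symm_apply_apply]
          omega
        · intro y hy
          obtain ⟨j, rfl⟩ := e.surjective y
          change R _ _ at hy
          simp only [R, OrderIso.symm_apply_apply] at hy
          congr 1
          apply Fin.ext
          simp
          omega
  · unfold numPM
    rw [Nat.card_eq_zero]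
    left
    constructor
    rintro ⟨M, hM⟩
    have h2 : n % 2 = 1 := Nat.odd_iff.1 (Nat.not_even_iff_odd.1 hn)
    obtain ⟨j, hj, -⟩ := hnext M hM (n / 2) ⟨n - 1, by omega⟩ (by simp; omega)
    have := j.isLt
    omega

/-- The strip graph: a path `0, 1, …, N-1` with chords between consecutive odd vertices. -/
def emGraph (N : ℕ) : SimpleGraph (Fin N) where
  Adj x y := (x.val + 1 = y.val ∨ (x.val % 2 = 1 ∧ x.val + 2 = y.val)) ∨
    (y.val + 1 = x.val ∨ (y.val % 2 = 1 ∧ y.val + 2 = x.val))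
  symm := ⟨fun _ _ h => Or.symm h⟩
  loopless := ⟨fun x h => by omega⟩

theorem emGraph_card (N : ℕ) : Nat.card (emGraph N).edgeSet ≤ N * 2 := by
  let F : Fin N × Fin 2 → Sym2 (Fin N) := fun p =>
    s(p.1, if h : p.1.val + 1 + p.2.val < N then ⟨_, h⟩ else p.1)
  have hsub : (emGraph N).edgeSet ⊆ Set.range F := by
    have key : ∀ x y : Fin N, (x.val + 1 = y.val ∨ (x.val % 2 = 1 ∧ x.val + 2 = y.val)) →
        s(x, y) ∈ Set.range F := by
      intro x y h
      have hy := y.isLt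
      rcases h with h | ⟨_, h⟩
      · refine ⟨(x, 0), ?_⟩
        have h' : x.val + 1 < N := by omega
        simp [F, h, h']
      · refine ⟨(x, 1), ?_⟩
        have h' : x.val + 1 + 1 < N := by omega
        have h'' : x.val + 1 + 1 = y.val := by omega
        simp [F, h'']
    intro s
    induction s using Sym2.ind with
    | _ x y =>
      intro h
      rw [SimpleGraph.mem_edgeSet] at h
      rcases h with h | h
      · exact key _ _ h
      · rw [Sym2.eq_swap]; exact key _ _ h
  calc Nat.card (emGraph N).edgeSet ≤ Nat.card (Set.range F) :=
        Nat.card_mono (Set.finite_range F) hsub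
    _ ≤ Nat.card (Fin N × Fin 2) := Finite.card_range_le F
    _ = N * 2 := by simp

/-- There is an absolute constant `C` such that for every `k ≥ 3` there is an unweighted
graph `H` with at most `C * k` vertices and edges, and `k` distinct distinguished
vertices `u 1, …, u k`, such that for every `S ⊆ {1, …, k}` the number of perfect
matchings of the induced subgraph `H - {u i : i ∈ S}` is `1` if `|S|` is even and `0`
if `|S|` is odd; i.e. `H` is an unweighted matchgate realizing `EVEN_k`. -/
theorem even_matchgate :
    ∃ C : ℕ, ∀ k : ℕ, 3 ≤ k →
      ∃ (N : ℕ) (H : SimpleGraph (Fin N)) (u : Fin k → Fin N),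
        Function.Injective u ∧
        N ≤ C * k ∧
        Nat.card H.edgeSet ≤ C * k ∧
        ∀ S : Finset (Fin k),
          numPM (H.induce ((↑(S.image u) : Set (Fin N))ᶜ)) =
            if Even S.card then 1 else 0 := by
  refine ⟨4, fun k _ => ⟨2 * k, emGraph (2 * k), fun i => ⟨2 * i.val, by omega⟩, ?_, by omega, ?_, ?_⟩⟩
  · intro i j h
    simp at h
    exact Fin.ext (by omega)
  · have := emGraph_card (2 * k)
    omega
  · intro S
    set u : Fin k → Fin (2 * k) := fun i => ⟨2 * i.val, by omega⟩ with hu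
    have huinj : Function.Injective u := by
      intro i j h
      simp [hu] at h
      exact Fin.ext (by omega)
    have hodd : ∀ x : Fin (2 * k), x.val % 2 = 1 → x ∈ ((↑(S.image u) : Set (Fin (2 * k)))ᶜ) := by
      intro x hx hmem
      simp only [Finset.coe_image, Set.mem_image] at hmem
      obtain ⟨i, _, rfl⟩ := hmem
      simp [hu] at hx
    have hcard : Fintype.card ↥((↑(S.image u) : Set (Fin (2 * k)))ᶜ) = 2 * k - S.card := by
      rw [Fintype.card_compl_set]
      simp [Finset.card_image_of_injective S huinj]
    have hle : S.card ≤ k := by simpa using Finset.card_le_univ S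
    rw [em_count _ (2 * k - S.card) (Fintype.orderIsoFinOfCardEq _ hcard)]
    · have : Even (2 * k - S.card) ↔ Even S.card := by
        rw [Nat.even_iff, Nat.even_iff]; omega
      simp only [this]
    · rintro ⟨a, ha⟩ ⟨b, hb⟩ ⟨hlt, hno⟩
      have hlt' : a.val < b.val := hlt
      have hb' := b.isLt
      have hmid : ∀ c : Fin (2 * k), a.val < c.val → c.val < b.val → c.val % 2 = 0 := by
        intro c h1 h2
        by_contra hc
        exact @hno ⟨c, hodd c (by omega)⟩ h1 h2
      change (a.val + 1 = b.val ∨ (a.val % 2 = 1 ∧ a.val + 2 = b.val)) ∨ _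
      left
      by_cases h1 : a.val + 1 = b.val
      · exact Or.inl h1
      · right
        have h2 := hmid ⟨a.val + 1, by omega⟩ (by simp) (by simp; omega)
        simp only at h2
        refine ⟨by omega, ?_⟩
        by_contra h3
        have h4 := hmid ⟨a.val + 2, by omega⟩ (by simp) (by simp; omega)
        simp only at h4
        omega
    · rintro ⟨a, ha⟩ ⟨b, hb⟩ hadj hlt hc
      have hlt' : a.val < b.val := hlt
      have hadj' : (a.val + 1 = b.val ∨ (a.val % 2 = 1 ∧ a.val + 2 = b.val)) ∨
        (b.val + 1 = a.val ∨ (b.val % 2 = 1 ∧ b.val + 2 = a.val)) := hadj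
      obtain ⟨⟨z, hz⟩, h1, h2⟩ := (not_covBy_iff hlt).1 hc
      have h1' : a.val < z.val := h1
      have h2' : z.val < b.val := h2
      refine ⟨⟨z, hz⟩, h1.ne', h2.ne, ?_⟩
      rintro ⟨w, hw⟩ hzw
      have hzw' : (z.val + 1 = w.val ∨ (z.val % 2 = 1 ∧ z.val + 2 = w.val)) ∨
        (w.val + 1 = z.val ∨ (w.val % 2 = 1 ∧ w.val + 2 = z.val)) := hzw
      simp only [Subtype.mk.injEq, Fin.ext_iff]
      omega
end

section
/- For every k ≥ 3, there exists an unweighted graph H with at most C·k vertices and edges (for an absolute constant C) and k distinct distinguished vertices u₁,…,u_k such that for every subset S ⊆ {1,…,k}, the number of perfect matchings of the induced subgraph H − {u_i : i ∈ S} equals 1 if |S| is odd and 0 if |S| is even. That is, H is an unweighted matchgate realizing the signature ODD_k. -/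
open scoped Classical

/-- The (infinite) chain graph: a path on `ℕ` together with the chords `{4i+2, 4i+4}`. -/
def chainG : SimpleGraph ℕ where
  Adj a b := b = a + 1 ∨ a = b + 1 ∨ (b = a + 2 ∧ a % 4 = 2) ∨ (a = b + 2 ∧ b % 4 = 2)
  symm := ⟨fun a b h => by omega⟩
  loopless := ⟨fun a h => by omega⟩

lemma chainG_adj (a b : ℕ) : chainG.Adj a b ↔
    b = a + 1 ∨ a = b + 1 ∨ (b = a + 2 ∧ a % 4 = 2) ∨ (a = b + 2 ∧ b % 4 = 2) := Iff.rfl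

/-- Perfect matchings of the chain graph on the vertex set `A`, as involutions. -/
def chainPM (A : Set ℕ) : Set (Equiv.Perm ℕ) :=
  {f | (∀ v, v ∉ A → f v = v) ∧ ∀ v ∈ A, f v ∈ A ∧ chainG.Adj v (f v) ∧ f (f v) = v}

lemma chainPM_swap {A : Set ℕ} {v w : ℕ} (hv : v ∈ A) (hw : w ∈ A)
    (h : chainG.Adj v w) (hf : ∀ f ∈ chainPM A, f v = w) :
    (chainPM A).ncard = (chainPM (A \ {v, w})).ncard := by
  have hvw : v ≠ w := h.ne
  refine Set.ncard_congr (fun f _ => f * Equiv.swap v w) ?_ ?_ ?_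
  · intro f hfA
    have h1 := hf f hfA
    obtain ⟨ha, hb⟩ := hfA
    have h2 : f w = v := by rw [← h1]; exact (hb v hv).2.2
    refine ⟨fun x hx => ?_, fun x hx => ?_⟩
    · by_cases hxv : x = v
      · subst hxv; simp [h2]
      by_cases hxw : x = w
      · subst hxw; simp [h1]
      simp only [Equiv.Perm.mul_apply, Equiv.swap_apply_of_ne_of_ne hxv hxw]
      apply ha
      intro hxA
      exact hx ⟨hxA, by simp [hxv, hxw]⟩
    · obtain ⟨hxA, hx'⟩ := hx
      simp only [Set.mem_insert_iff, Set.mem_singleton_iff, not_or] at hx'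
      obtain ⟨hxv, hxw⟩ := hx'
      have hb' := hb x hxA
      have n1 : f x ≠ v := fun h' => hxw (f.injective (h'.trans h2.symm))
      have n2 : f x ≠ w := fun h' => hxv (f.injective (h'.trans h1.symm))
      simp only [Equiv.Perm.mul_apply, Equiv.swap_apply_of_ne_of_ne hxv hxw,
        Equiv.swap_apply_of_ne_of_ne n1 n2]
      exact ⟨⟨hb'.1, by simp [n1, n2]⟩, hb'.2⟩
  · intro f g _ _ hfg
    exact mul_right_cancel hfg
  · intro g hg
    obtain ⟨ha, hb⟩ := hg
    have gv : g v = v := ha v (by simp)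
    have gw : g w = w := ha w (by simp)
    refine ⟨g * Equiv.swap v w, ⟨fun x hx => ?_, fun x hx => ?_⟩, ?_⟩
    · have hxv : x ≠ v := fun h' => hx (h' ▸ hv)
      have hxw : x ≠ w := fun h' => hx (h' ▸ hw)
      simp only [Equiv.Perm.mul_apply, Equiv.swap_apply_of_ne_of_ne hxv hxw]
      exact ha x (fun h' => hx h'.1)
    · by_cases hxv : x = v
      · subst hxv; simp [gv, gw, h, hw]
      by_cases hxw : x = w
      · subst hxw; simp [gv, gw, h.symm, hv]
      have hb' := hb x ⟨hx, by simp [hxv, hxw]⟩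
      have n1 : g x ≠ v := fun h' => hb'.1.2 (by simp [h'])
      have n2 : g x ≠ w := fun h' => hb'.1.2 (by simp [h'])
      simp only [Equiv.Perm.mul_apply, Equiv.swap_apply_of_ne_of_ne hxv hxw,
        Equiv.swap_apply_of_ne_of_ne n1 n2]
      exact ⟨hb'.1.1, hb'.2⟩
    · rw [mul_assoc, Equiv.swap_mul_self, mul_one]

lemma chainPM_swap' {A B : Set ℕ} (v w : ℕ) (hv : v ∈ A) (hw : w ∈ A)
    (h : chainG.Adj v w) (hf : ∀ y ∈ A, chainG.Adj v y → y = w)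
    (hB : ∀ x, x ∈ B ↔ x ∈ A ∧ x ≠ v ∧ x ≠ w) :
    (chainPM A).ncard = (chainPM B).ncard := by
  have : B = A \ {v, w} := by ext x; simp [hB]
  rw [this]
  exact chainPM_swap hv hw h (fun f hfA => hf _ (hfA.2 v hv).1 (hfA.2 v hv).2.1)

/-- Vertices below `n` with the attachment vertices `4i+3`, `p i`, removed. -/
def chainA (p : ℕ → Prop) (n : ℕ) : Set ℕ := {x | x < n ∧ ¬ (x % 4 = 3 ∧ p (x / 4))}

lemma chain_count (p : ℕ → Prop) (m : ℕ) :
    ((chainPM (chainA p (4 * m + 1))).ncard =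
      if Odd ((Finset.range m).filter p).card then 1 else 0) ∧
    ((chainPM (chainA p (4 * m))).ncard =
      if Odd ((Finset.range m).filter p).card then 0 else 1) := by
  induction m with
  | zero =>
    constructor
    · have : chainPM (chainA p (4 * 0 + 1)) = ∅ := by
        ext f
        simp only [Set.mem_empty_iff_false, iff_false]
        rintro ⟨_, hb⟩
        obtain ⟨h1, h2, _⟩ := hb 0 (by simp [chainA])
        have h3 : f 0 = 0 := by have := h1.1; omega
        exact h2.ne h3.symm
      simp [this]
    · have : chainPM (chainA p (4 * 0)) = {1} := by
        ext f
        simp only [Set.mem_singleton_iff]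
        constructor
        · rintro ⟨ha, _⟩
          ext x
          simp [ha x (by simp [chainA])]
        · rintro rfl
          exact ⟨fun _ _ => rfl, fun v hv => by simp [chainA] at hv⟩
      rw [this]; simp
  | succ m ih =>
    obtain ⟨ih1, ih2⟩ := ih
    -- the step from `4m+2` to `4m`
    have s2 : (chainPM (chainA p (4 * m + 2))).ncard = (chainPM (chainA p (4 * m))).ncard := by
      refine chainPM_swap' (4 * m + 1) (4 * m) ?_ ?_ ?_ ?_ ?_
      · exact ⟨by omega, by omega⟩
      · exact ⟨by omega, by omega⟩
      · rw [chainG_adj]; omega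
      · rintro y ⟨hy, _⟩ h; rw [chainG_adj] at h; omega
      · intro x
        simp only [chainA, Set.mem_ofPred_eq]
        constructor
        · rintro ⟨a, b⟩; exact ⟨⟨by omega, b⟩, by omega, by omega⟩
        · rintro ⟨⟨a, b⟩, c, d⟩; exact ⟨by omega, b⟩
    have s3 : (chainPM (chainA p (4 * m + 3))).ncard
        = (chainPM (chainA p (4 * m + 1))).ncard := by
      refine chainPM_swap' (4 * m + 2) (4 * m + 1) ?_ ?_ ?_ ?_ ?_
      · exact ⟨by omega, by omega⟩
      · exact ⟨by omega, by omega⟩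
      · rw [chainG_adj]; omega
      · rintro y ⟨hy, _⟩ h; rw [chainG_adj] at h; omega
      · intro x
        simp only [chainA, Set.mem_ofPred_eq]
        constructor
        · rintro ⟨a, b⟩; exact ⟨⟨by omega, b⟩, by omega, by omega⟩
        · rintro ⟨⟨a, b⟩, c, d⟩; exact ⟨by omega, b⟩
    have hm : (4 * m + 3) / 4 = m := by omega
    rw [Finset.range_add_one, Finset.filter_insert]
    by_cases hp : p m
    · rw [if_pos hp, Finset.card_insert_of_notMem (by simp)]
      have t1 : (chainPM (chainA p (4 * (m + 1) + 1))).ncard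
          = (chainPM (chainA p (4 * m + 2))).ncard := by
        have hn : 4 * m + 3 ∉ chainA p (4 * (m + 1) + 1) := by
          rintro ⟨_, h⟩; exact h ⟨by omega, hm.symm ▸ hp⟩
        refine chainPM_swap' (4 * m + 4) (4 * m + 2) ?_ ?_ ?_ ?_ ?_
        · exact ⟨by omega, by omega⟩
        · exact ⟨by omega, by omega⟩
        · rw [chainG_adj]; omega
        · intro y hy h
          have : y ≠ 4 * m + 3 := fun h' => hn (h' ▸ hy)
          have := hy.1
          rw [chainG_adj] at h; omega
        · intro x
          constructor
          · rintro ⟨a, b⟩; exact ⟨⟨by omega, b⟩, by omega, by omega⟩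
          · rintro ⟨hx, c, d⟩
            have : x ≠ 4 * m + 3 := fun h' => hn (h' ▸ hx)
            obtain ⟨a, b⟩ := hx
            exact ⟨by omega, b⟩
      have t2 : chainA p (4 * (m + 1)) = chainA p (4 * m + 3) := by
        ext x
        simp only [chainA, Set.mem_ofPred_eq]
        constructor
        · rintro ⟨a, b⟩
          have : x ≠ 4 * m + 3 := by
            rintro rfl; exact b ⟨by omega, hm.symm ▸ hp⟩
          exact ⟨by omega, b⟩
        · rintro ⟨a, b⟩; exact ⟨by omega, b⟩
      rw [t1, s2, ih2, t2, s3, ih1]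
      simp only [Nat.odd_add_one, ite_not, and_self]
    · rw [if_neg hp]
      have h3 : ∀ n, 4 * m + 3 < n → 4 * m + 3 ∈ chainA p n :=
        fun n hn => ⟨hn, fun h => hp (hm ▸ h.2)⟩
      have t2 : (chainPM (chainA p (4 * (m + 1)))).ncard
          = (chainPM (chainA p (4 * m + 2))).ncard := by
        refine chainPM_swap' (4 * m + 3) (4 * m + 2) (h3 _ (by omega)) ?_ ?_ ?_ ?_
        · exact ⟨by omega, by omega⟩
        · rw [chainG_adj]; omega
        · intro y hy h
          have := hy.1
          rw [chainG_adj] at h; omega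
        · intro x
          constructor
          · rintro ⟨a, b⟩; exact ⟨⟨by omega, b⟩, by omega, by omega⟩
          · rintro ⟨⟨a, b⟩, c, d⟩; exact ⟨by omega, b⟩
      have t1 : (chainPM (chainA p (4 * (m + 1) + 1))).ncard
          = (chainPM (chainA p (4 * m + 3))).ncard := by
        have e : chainA p (4 * m + 3)
            = chainA p (4 * (m + 1) + 1) \ {4 * m + 4, 4 * m + 3} := by
          ext x
          simp only [Set.mem_sdiff, Set.mem_insert_iff, Set.mem_singleton_iff, not_or]
          constructor
          · rintro ⟨a, b⟩; exact ⟨⟨by omega, b⟩, by omega, by omega⟩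
          · rintro ⟨⟨a, b⟩, c, d⟩; exact ⟨by omega, b⟩
        have h4 : 4 * m + 4 ∈ chainA p (4 * (m + 1) + 1) := ⟨by omega, by omega⟩
        have h3' := h3 (4 * (m + 1) + 1) (by omega)
        rw [e]
        refine chainPM_swap h4 h3' ?_ ?_
        · rw [chainG_adj]; omega
        · rintro f ⟨_, hb⟩
          obtain ⟨a1, a2, a3⟩ := hb _ h4
          obtain ⟨b1, b2, b3⟩ := hb _ h3'
          have a1' := a1.1
          have b1' := b1.1
          rw [chainG_adj] at a2 b2
          have ha : f (4 * m + 4) = 4 * m + 3 ∨ f (4 * m + 4) = 4 * m + 2 := by omega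
          have hb : f (4 * m + 3) = 4 * m + 4 ∨ f (4 * m + 3) = 4 * m + 2 := by omega
          rcases ha with ha | ha
          · exact ha
          · rcases hb with hb | hb
            · rw [hb] at b3; exact b3
            · have := f.injective (ha.trans hb.symm); omega
      rw [t1, s3, ih1, t2, s2, ih2]
      simp

lemma numPM_eq_chain {α : Type} (H : SimpleGraph α) (e : α → ℕ) (he : Function.Injective e)
    (hadj : ∀ x y, H.Adj x y ↔ chainG.Adj (e x) (e y)) (A : Set ℕ) (hA : Set.range e = A) :
    numPM H = (chainPM A).ncard := by
  subst hA
  rw [numPM, ← Nat.card_coe_set_eq]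
  symm
  let F : chainPM (Set.range e) → {M : H.Subgraph // M.IsPerfectMatching} := fun f =>
    ⟨{ verts := Set.univ
       Adj := fun x y => f.1 (e x) = e y
       adj_sub := fun {x y} h => by
         rw [hadj, ← h]; exact (f.2.2 (e x) ⟨x, rfl⟩).2.1
       edge_vert := fun _ => trivial
       symm := ⟨fun x y h => by
         rw [← h]; exact (f.2.2 (e x) ⟨x, rfl⟩).2.2⟩ }, by
      rw [SimpleGraph.Subgraph.isPerfectMatching_iff]
      intro x
      obtain ⟨y, hy⟩ := (f.2.2 (e x) ⟨x, rfl⟩).1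
      refine ⟨y, hy.symm, fun z hz => he ?_⟩
      have hz' : f.1 (e x) = e z := hz
      exact hz'.symm.trans hy.symm⟩
  refine Nat.card_eq_of_bijective F ⟨?_, ?_⟩
  · intro f g hfg
    apply Subtype.ext
    ext n
    by_cases hn : n ∈ Set.range e
    · obtain ⟨x, rfl⟩ := hn
      obtain ⟨y, hy⟩ := (f.2.2 (e x) ⟨x, rfl⟩).1
      have h1 : (F f).1.Adj x y := hy.symm
      rw [hfg] at h1
      have h2 : g.1 (e x) = e y := h1
      rw [h2, hy]
    · rw [f.2.1 n hn, g.2.1 n hn]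
  · rintro ⟨M, hM⟩
    have hM' := SimpleGraph.Subgraph.isPerfectMatching_iff.1 hM
    choose g hg hg' using hM'
    have gg : ∀ x, g (g x) = x := fun x => (hg' (g x) x (hg x).symm).symm
    let φ : ℕ → ℕ := fun n => if h : ∃ x, e x = n then e (g h.choose) else n
    have φe : ∀ x, φ (e x) = e (g x) := by
      intro x
      have h : ∃ y, e y = e x := ⟨x, rfl⟩
      have : h.choose = x := he h.choose_spec
      simp only [φ, dif_pos h, this]
    have φn : ∀ n, n ∉ Set.range e → φ n = n := by
      intro n hn
      simp only [φ]; rw [dif_neg]; exact hn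
    have inv : Function.Involutive φ := by
      intro n
      by_cases hn : n ∈ Set.range e
      · obtain ⟨x, rfl⟩ := hn
        rw [φe, φe, gg]
      · rw [φn n hn, φn n hn]
    refine ⟨⟨inv.toPerm, ⟨fun n hn => φn n hn, ?_⟩⟩, ?_⟩
    · rintro _ ⟨x, rfl⟩
      refine ⟨?_, ?_, inv _⟩
      · exact ⟨g x, (φe x).symm⟩
      · change chainG.Adj (e x) (φ (e x))
        rw [φe, ← hadj]; exact (hg x).adj_sub
    · apply Subtype.ext
      apply SimpleGraph.Subgraph.ext
      · exact (SimpleGraph.Subgraph.isSpanning_iff.1 hM.2).symm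
      · funext x y
        change (φ (e x) = e y) = M.Adj x y
        rw [φe]
        apply propext
        constructor
        · intro h; rw [← he h]; exact hg x
        · intro h; rw [hg' x y h]

/-- There is an absolute constant `C` such that for every `k ≥ 3` there is an unweighted
graph `H` with at most `C * k` vertices and edges, and `k` distinct distinguished
vertices `u 1, …, u k`, such that for every `S ⊆ {1, …, k}` the number of perfect
matchings of the induced subgraph `H - {u i : i ∈ S}` is `1` if `|S|` is odd and `0`
if `|S|` is even; i.e. `H` is an unweighted matchgate realizing `ODD_k`. -/
theorem odd_matchgate :
    ∃ C : ℕ, ∀ k : ℕ, 3 ≤ k →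
      ∃ (N : ℕ) (H : SimpleGraph (Fin N)) (u : Fin k → Fin N),
        Function.Injective u ∧
        N ≤ C * k ∧
        Nat.card H.edgeSet ≤ C * k ∧
        ∀ S : Finset (Fin k),
          numPM (H.induce ((↑(S.image u) : Set (Fin N))ᶜ)) =
            if Odd S.card then 1 else 0 := by
  refine ⟨8, fun k hk => ?_⟩
  obtain ⟨m, rfl⟩ : ∃ m, k = m + 1 := ⟨k - 1, by omega⟩
  let u : Fin (m + 1) → Fin (4 * m + 1) := fun i =>
    ⟨if i.1 < m then 4 * i.1 + 3 else 4 * m, by split_ifs <;> omega⟩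
  have hu : ∀ i, (u i).1 = if i.1 < m then 4 * i.1 + 3 else 4 * m := fun _ => rfl
  refine ⟨4 * m + 1, chainG.comap Fin.val, u, ?_, by omega, ?_, ?_⟩
  · intro i j hij
    have h := congrArg Fin.val hij
    rw [hu, hu] at h
    apply Fin.ext
    have := i.2
    have := j.2
    split_ifs at h <;> omega
  · let c : Fin (4 * m + 1) × Bool → Sym2 (Fin (4 * m + 1)) := fun q =>
      s(q.1, Fin.ofNat (4 * m + 1) (q.1.1 + if q.2 then 1 else 2))
    have hsub : (chainG.comap (Fin.val : Fin (4 * m + 1) → ℕ)).edgeSet ⊆ Set.range c := by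
      intro s
      induction s using Sym2.ind with
      | _ a b =>
        intro h
        have hv : ∀ (a b : Fin (4 * m + 1)) (d : ℕ), b.1 = a.1 + d →
            Fin.ofNat (4 * m + 1) (a.1 + d) = b := by
          intro a b d hd
          apply Fin.ext
          simp only [Fin.ofNat]
          rw [← hd]; exact Nat.mod_eq_of_lt b.2
        have h' : chainG.Adj a.1 b.1 := h
        rcases h' with h | h | ⟨h, _⟩ | ⟨h, _⟩
        · exact ⟨(a, true), by simp only [c, if_true]; rw [hv a b 1 h]⟩
        · exact ⟨(b, true), by simp only [c, if_true]; rw [hv b a 1 h, Sym2.eq_swap]⟩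
        · exact ⟨(a, false), by
            simp only [c, Bool.false_eq_true, if_false]; rw [hv a b 2 h]⟩
        · exact ⟨(b, false), by
            simp only [c, Bool.false_eq_true, if_false]; rw [hv b a 2 h, Sym2.eq_swap]⟩
    rw [Nat.card_coe_set_eq]
    refine (Set.ncard_le_ncard hsub (Set.toFinite _)).trans ?_
    rw [← Set.image_univ]
    refine (Set.ncard_image_le (Set.toFinite _)).trans ?_
    rw [Set.ncard_univ, Nat.card_eq_fintype_card]
    simp only [Fintype.card_prod, Fintype.card_fin, Fintype.card_bool]
    omega
  · intro S
    let p : ℕ → Prop := fun i => ∃ h : i < m + 1, (⟨i, h⟩ : Fin (m + 1)) ∈ S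
    have hcard : S.card = ((Finset.range (m + 1)).filter p).card := by
      rw [← Finset.card_map Fin.valEmbedding]
      congr 1
      ext x
      simp only [Finset.mem_map, Fin.valEmbedding_apply, Finset.mem_filter, Finset.mem_range, p]
      constructor
      · rintro ⟨y, hy, rfl⟩; exact ⟨y.2, y.2, hy⟩
      · rintro ⟨_, h, hx⟩; exact ⟨_, hx, rfl⟩
    have hmem : ∀ x : Fin (4 * m + 1), x ∈ S.image u ↔
        (x.1 = 4 * m ∧ p m) ∨ (x.1 % 4 = 3 ∧ p (x.1 / 4)) := by
      intro x
      rw [Finset.mem_image]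
      have hx := x.2
      constructor
      · rintro ⟨i, hi, rfl⟩
        have hi2 := i.2
        by_cases him : i.1 < m
        · right
          rw [hu, if_pos him]
          have : (4 * i.1 + 3) / 4 = i.1 := by omega
          rw [this]
          exact ⟨by omega, i.2, hi⟩
        · left
          rw [hu, if_neg him]
          have : i.1 = m := by omega
          rw [← this]
          exact ⟨rfl, i.2, hi⟩
      · rintro (⟨h1, h2, h3⟩ | ⟨h1, h2, h3⟩)
        · exact ⟨_, h3, Fin.ext (by rw [hu]; simp [h1])⟩
        · exact ⟨_, h3, Fin.ext (by
            rw [hu]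
            have : x.1 / 4 < m := by omega
            simp only [this, if_true]; omega)⟩
    have hnum := fun A hA => numPM_eq_chain
      ((chainG.comap (Fin.val : Fin (4 * m + 1) → ℕ)).induce
        ((↑(S.image u) : Set (Fin (4 * m + 1)))ᶜ))
      (fun x => x.1.1) (fun x y h => Subtype.ext (Fin.ext h)) (fun x y => Iff.rfl) A hA
    rw [hcard, Finset.range_add_one, Finset.filter_insert]
    by_cases hp : p m
    · rw [if_pos hp, Finset.card_insert_of_notMem (by simp), hnum (chainA p (4 * m)) ?_,
        (chain_count p m).2]
      · simp only [Nat.odd_add_one, ite_not]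
        congr!
      · ext n
        constructor
        · rintro ⟨⟨x, hx⟩, rfl⟩
          have hx' : x ∉ S.image u := by simpa only [Set.mem_compl_iff, Finset.mem_coe] using hx
          rw [hmem] at hx'
          have := x.2
          refine ⟨?_, fun h => hx' (Or.inr h)⟩
          have : x.1 ≠ 4 * m := fun h => hx' (Or.inl ⟨h, hp⟩)
          change x.1 < 4 * m
          omega
        · rintro ⟨h1, h2⟩
          refine ⟨⟨⟨n, by omega⟩, ?_⟩, rfl⟩
          rw [Set.mem_compl_iff, Finset.mem_coe, hmem]
          rintro (⟨h, _⟩ | h)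
          · change n = 4 * m at h
            omega
          · exact h2 h
    · rw [if_neg hp, hnum (chainA p (4 * m + 1)) ?_, (chain_count p m).1]
      · congr!
      · ext n
        constructor
        · rintro ⟨⟨x, hx⟩, rfl⟩
          have hx' : x ∉ S.image u := by simpa only [Set.mem_compl_iff, Finset.mem_coe] using hx
          rw [hmem] at hx'
          exact ⟨x.2, fun h => hx' (Or.inr h)⟩
        · rintro ⟨h1, h2⟩
          refine ⟨⟨⟨n, by omega⟩, ?_⟩, rfl⟩
          rw [Set.mem_compl_iff, Finset.mem_coe, hmem]
          rintro (⟨_, h⟩ | h)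
          · exact hp h
          · exact h2 h
end

section
/- There exists a finite graph H with vertex weights in {−1, 0, 1} and two distinguished distinct vertices a and b such that MatchSum(H) = 1, MatchSum(H − a) = 0, MatchSum(H − b) = 0, and MatchSum(H − {a, b}) = −1, where H − S denotes the induced subgraph obtained by deleting the vertices in S. (Equivalently, H is a gate built only from vertex functions VTX_w, w ∈ {−1,0,1}, realizing the binary signature EDGE₋₁ that maps 11 ↦ −1, 00 ↦ 1, and 01, 10 ↦ 0.) -/
open scoped Classical

/-- A vertex `v` is incident with an edge `e`. -/
def Inc {V E : Type} (ends : E → V × V) (v : V) (e : E) : Prop :=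
  v = (ends e).1 ∨ v = (ends e).2

/-- `M` is a matching: no vertex lies on two distinct edges of `M`. -/
def IsMatching {V E : Type} (ends : E → V × V) (M : Finset E) : Prop :=
  ∀ v : V, ∀ e ∈ M, ∀ e' ∈ M, Inc ends v e → Inc ends v e' → e = e'

/-- The set of vertices unmatched by `M`. -/
noncomputable def unsat {V E : Type} [Fintype V] (ends : E → V × V)
    (M : Finset E) : Finset V :=
  Finset.univ.filter fun v => ∀ e ∈ M, ¬ Inc ends v e

/-- `MatchSum` of the induced subgraph obtained by deleting the vertex set `A`:
the sum over all matchings avoiding `A` of the product of the weights of the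
unmatched vertices outside `A`. -/
noncomputable def delMatchSum {V E : Type} [Fintype V] [Fintype E]
    (ends : E → V × V) (wv : V → ℚ) (A : Finset V) : ℚ :=
  ∑ M ∈ Finset.univ.filter fun M : Finset E =>
      IsMatching ends M ∧ ∀ e ∈ M, (ends e).1 ∉ A ∧ (ends e).2 ∉ A,
    ∏ v ∈ unsat ends M \ A, wv v

/-- There is a finite graph `H` with vertex weights in `{-1, 0, 1}` and two
distinguished distinct vertices `a`, `b` with `MatchSum H = 1`,
`MatchSum (H - a) = 0`, `MatchSum (H - b) = 0` and `MatchSum (H - {a, b}) = -1`;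
i.e. `H` is a gate built from the vertex functions `VTX_w`, `w ∈ {-1,0,1}`,
realizing the binary signature `EDGE₋₁`. -/
theorem edge_minus_one_gate :
    ∃ (N M : ℕ) (ends : Fin M → Fin N × Fin N) (wv : Fin N → ℚ) (a b : Fin N),
      a ≠ b ∧
      (∀ v, wv v = -1 ∨ wv v = 0 ∨ wv v = 1) ∧
      delMatchSum ends wv ∅ = 1 ∧
      delMatchSum ends wv {a} = 0 ∧
      delMatchSum ends wv {b} = 0 ∧
      delMatchSum ends wv {a, b} = -1 := by
  -- the path `0 - 2 - 1` with weights `1, -1, 1` at `0, 2, 1`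
  have key : ∀ A : Finset (Fin 3),
      delMatchSum (![(0, 2), (1, 2)] : Fin 2 → Fin 3 × Fin 3) ![1, 1, -1] A =
        ∑ M : Finset (Fin 2),
          if (¬ (0 ∈ M ∧ 1 ∈ M)) ∧ (0 ∈ M → 0 ∉ A ∧ 2 ∉ A) ∧ (1 ∈ M → 1 ∉ A ∧ 2 ∉ A) then
            (if 0 ∉ M ∧ 0 ∉ A then 1 else 1) * (if 1 ∉ M ∧ 1 ∉ A then 1 else 1) *
              (if 0 ∉ M ∧ 1 ∉ M ∧ 2 ∉ A then (-1 : ℚ) else 1) else 0 := by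
    intro A
    unfold delMatchSum
    rw [Finset.sum_filter]
    refine Finset.sum_congr rfl fun M _ => ?_
    have h1 : IsMatching (![(0, 2), (1, 2)] : Fin 2 → Fin 3 × Fin 3) M ↔
        ¬ (0 ∈ M ∧ 1 ∈ M) := by
      unfold IsMatching Inc
      simp only [Fin.forall_fin_succ]
      simp
      try tauto
    have h2 : (∀ e ∈ M, ((![(0, 2), (1, 2)] : Fin 2 → Fin 3 × Fin 3) e).1 ∉ A ∧
        ((![(0, 2), (1, 2)] : Fin 2 → Fin 3 × Fin 3) e).2 ∉ A) ↔
        (0 ∈ M → 0 ∉ A ∧ 2 ∉ A) ∧ (1 ∈ M → 1 ∉ A ∧ 2 ∉ A) := by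
      simp [Fin.forall_fin_two]
    have h3 : ∀ S : Finset (Fin 3), (∀ v, v ∈ S ↔ ((∀ e ∈ M,
          ¬ Inc (![(0, 2), (1, 2)] : Fin 2 → Fin 3 × Fin 3) v e) ∧ v ∉ A)) →
        ∏ v ∈ S, (![1, 1, -1] : Fin 3 → ℚ) v =
          if 0 ∉ M ∧ 1 ∉ M ∧ 2 ∉ A then (-1 : ℚ) else 1 := by
      intro S hS
      have hS' : S = Finset.univ.filter fun v => v ∈ S := by simp
      rw [hS', Finset.prod_filter, Fin.prod_univ_three]
      simp [hS, Inc, Fin.forall_fin_two, and_assoc]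
    rw [h3]
    swap
    · intro v
      simp [unsat]
    simp [h1, h2]
  have hu : (Finset.univ : Finset (Finset (Fin 2))) = {∅, {0}, {1}, {0, 1}} := by
    decide
  have hsum : ∀ f : Finset (Fin 2) → ℚ,
      ∑ M : Finset (Fin 2), f M = f ∅ + f {0} + f {1} + f {0, 1} := by
    intro f
    rw [hu, Finset.sum_insert (by decide), Finset.sum_insert (by decide),
      Finset.sum_insert (by decide), Finset.sum_singleton]
    ring
  refine ⟨3, 2, ![(0, 2), (1, 2)], ![1, 1, -1], 0, 1, by decide, ?_, ?_, ?_, ?_, ?_⟩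
  · intro v
    fin_cases v <;> simp
  all_goals
    rw [key, hsum]
    simp
end

section
/- For every finite graph G with n vertices and m edges, all edge weights lying in {−1, 1}, there exists a graph G′ with at most C·(n+m) vertices and edges (for an absolute constant C), with vertex weights in {−1, 0, 1}, such that PerfMatch(G) = MatchSum(G′). -/
open scoped Classical

/-- `M` is a perfect matching: every vertex lies on exactly one edge of `M`. -/
def IsPM {V E : Type} (ends : E → V × V) (M : Finset E) : Prop :=
  ∀ v : V, ∃! e, e ∈ M ∧ Inc ends v e

/-- `PerfMatch` of an edge-weighted graph. -/
noncomputable def perfMatch {V E : Type} [Fintype V] [Fintype E]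
    (ends : E → V × V) (w : E → ℚ) : ℚ :=
  ∑ M ∈ Finset.univ.filter (IsPM ends), ∏ e ∈ M, w e

/-- `MatchSum` of a vertex-weighted graph. -/
noncomputable def matchSum {V E : Type} [Fintype V] [Fintype E]
    (ends : E → V × V) (wv : V → ℚ) : ℚ :=
  ∑ M ∈ Finset.univ.filter (IsMatching ends), ∏ v ∈ unsat ends M, wv v

noncomputable def gg (x : ℚ) (n : ℕ) : ℚ := if n = 0 then x else if n = 1 then 1 else 0

noncomputable def ind (p : Prop) : ℕ := if p then 1 else 0

theorem ind_true : ind True = 1 := by simp [ind]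
theorem ind_false : ind False = 0 := by simp [ind]

noncomputable def dg {V E : Type} (ends : E → V × V) (M : Finset E) (v : V) : ℕ :=
  ∑ e ∈ M, ind (Inc ends v e)

theorem dg_card {V E : Type} (ends : E → V × V) (M : Finset E) (v : V) :
    dg ends M v = (M.filter (Inc ends v)).card := by
  simp only [dg, ind, Finset.card_filter]

theorem matchSum_eq {V E : Type} [Fintype V] [Fintype E]
    (ends : E → V × V) (wv : V → ℚ) :
    matchSum ends wv = ∑ M : Finset E, ∏ v, gg (wv v) (dg ends M v) := by
  unfold matchSum
  rw [Finset.sum_filter]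
  refine Finset.sum_congr rfl fun M _ => ?_
  split_ifs with h
  · rw [unsat, Finset.prod_filter]
    refine Finset.prod_congr rfl fun v _ => ?_
    have h1 : dg ends M v ≤ 1 := by
      rw [dg_card, Finset.card_le_one]
      intro a ha b hb
      simp only [Finset.mem_filter] at ha hb
      exact h v a ha.1 b hb.1 ha.2 hb.2
    have h0 : (∀ e ∈ M, ¬ Inc ends v e) ↔ dg ends M v = 0 := by
      rw [dg_card, Finset.card_eq_zero, Finset.filter_eq_empty_iff]
    simp only [h0, gg]
    split_ifs <;> first | rfl | omega
  · unfold IsMatching at h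
    push Not at h
    obtain ⟨v, a, ha, b, hb, h1, h2, h3⟩ := h
    symm
    apply Finset.prod_eq_zero (Finset.mem_univ v)
    have : 1 < dg ends M v := by
      rw [dg_card, Finset.one_lt_card]
      exact ⟨a, by simp [ha, h1], b, by simp [hb, h2], h3⟩
    simp only [gg]
    split_ifs <;> first | rfl | omega

theorem perfMatch_eq {V E : Type} [Fintype V] [Fintype E]
    (ends : E → V × V) (w : E → ℚ) :
    perfMatch ends w = ∑ M : Finset E, (∏ e ∈ M, w e) * ∏ v, gg 0 (dg ends M v) := by
  unfold perfMatch
  rw [Finset.sum_filter]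
  refine Finset.sum_congr rfl fun M _ => ?_
  have key : ∀ v, (∃! e, e ∈ M ∧ Inc ends v e) ↔ dg ends M v = 1 := by
    intro v
    rw [dg_card, Finset.card_eq_one]
    constructor
    · rintro ⟨e, he, hu⟩
      refine ⟨e, ?_⟩
      ext f
      simp only [Finset.mem_filter, Finset.mem_singleton]
      exact ⟨fun h => hu f h, fun h => h ▸ he⟩
    · rintro ⟨e, he⟩
      have : ∀ f, f ∈ M ∧ Inc ends v f ↔ f = e := by
        intro f
        rw [← Finset.mem_filter, he, Finset.mem_singleton]
      exact ⟨e, (this e).2 rfl, fun f hf => (this f).1 hf⟩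
  split_ifs with h
  · rw [Finset.prod_eq_one (s := Finset.univ), mul_one]
    intro v _
    have := (key v).1 (h v)
    simp [gg, this]
  · unfold IsPM at h
    push Not at h
    obtain ⟨v, hv⟩ := h
    rw [key] at hv
    rw [Finset.prod_eq_zero (Finset.mem_univ v), mul_zero]
    simp [gg, hv]

theorem matchSum_equiv {V E V' E' : Type} [Fintype V] [Fintype E] [Fintype V'] [Fintype E']
    (ends : E → V × V) (wv : V → ℚ) (f : V' ≃ V) (g : E' ≃ E) :
    matchSum (fun e => ((f.symm (ends (g e)).1), (f.symm (ends (g e)).2))) (fun v => wv (f v))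
      = matchSum ends wv := by
  rw [matchSum_eq, matchSum_eq, ← (Equiv.finsetCongr g).sum_comp]
  refine Finset.sum_congr rfl fun M _ => ?_
  rw [← f.prod_comp]
  refine Finset.prod_congr rfl fun v _ => ?_
  congr 1
  simp [dg, Inc, Equiv.eq_symm_apply]

abbrev Alg (V : Type) := AddMonoidAlgebra ℚ (V → ℕ)

noncomputable def sg {V : Type} (b : V → ℕ) (q : ℚ) : Alg V := AddMonoidAlgebra.single b q

theorem sum16 {A : Type} [AddCommMonoid A] (F : Finset (Fin 4) → A) :
    ∑ S, F S = F ∅ + F {0} + F {1} + F {2} + F {3} + F {0,1} + F {0,2} + F {0,3} + F {1,2}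
      + F {1,3} + F {2,3} + F {0,1,2} + F {0,1,3} + F {0,2,3} + F {1,2,3} + F {0,1,2,3} := by
  have : (Finset.univ : Finset (Finset (Fin 4))) = {∅, {0}, {1}, {2}, {3}, {0,1}, {0,2}, {0,3},
      {1,2}, {1,3}, {2,3}, {0,1,2}, {0,1,3}, {0,2,3}, {1,2,3}, {0,1,2,3}} := by decide
  rw [this]
  repeat rw [Finset.sum_insert (by decide)]
  rw [Finset.sum_singleton]
  simp only [add_assoc]

theorem gadget {V E : Type} (ends : E → V × V) (w : E → ℚ) (e : E) (hw : w e = 1 ∨ w e = -1) :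
    ∃ (G : Fin 4 → (V ⊕ Fin 3) × (V ⊕ Fin 3)) (x : Fin 3 → ℚ),
      (∀ i, x i = -1 ∨ x i = 0 ∨ x i = 1) ∧
      ∑ A : Finset (Fin 4), sg (fun v => dg G A (Sum.inl v)) (∏ i, gg (x i) (dg G A (Sum.inr i)))
        = 1 + sg (fun v => ind (Inc ends v e)) (w e) := by
  have h1 : (1 : Alg V) = sg (fun _ => 0) 1 := rfl
  have h0 : ∀ b : V → ℕ, sg b 0 = 0 := fun b => AddMonoidAlgebra.single_zero b
  have hneg : ∀ b : V → ℕ, sg b (-1) = - sg b 1 := fun b => AddMonoidAlgebra.single_neg b 1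
  rcases hw with hw | hw
  · refine ⟨![(.inl (ends e).1, .inl (ends e).2), (.inr 0, .inr 0), (.inr 1, .inr 1),
      (.inr 2, .inr 2)], ![0, 0, 0], ?_, ?_⟩
    · intro i; fin_cases i <;> simp
    · rw [sum16, hw, h1]
      simp [dg, Inc, ind_true, ind_false, gg, Fin.prod_univ_three, h0]
  · by_cases hl : (ends e).1 = (ends e).2
    · refine ⟨![(.inl (ends e).1, .inr 0), (.inr 0, .inr 1), (.inr 2, .inr 2),
        (.inr 2, .inr 2)], ![0, -1, -1], ?_, ?_⟩
      · intro i; fin_cases i <;> simp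
      · rw [sum16, hw, h1]
        simp [dg, Inc, ind_true, ind_false, gg, Fin.prod_univ_three, h0, ← hl]
        simp only [hneg]
        abel
    · refine ⟨![(.inl (ends e).1, .inr 0), (.inr 0, .inr 2), (.inr 2, .inr 1),
        (.inr 1, .inl (ends e).2)], ![1, 1, -1], ?_, ?_⟩
      · intro i; fin_cases i <;> simp
      · have hχ : (fun v => ind (v = (ends e).1 ∨ v = (ends e).2) : V → ℕ)
          = fun v => ind (v = (ends e).1) + ind (v = (ends e).2) := by
          funext v
          simp only [ind]
          grind
        rw [sum16, hw, h1]
        simp [dg, Inc, ind_true, ind_false, gg, Fin.prod_univ_three, h0, hχ]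
        simp only [hneg]
        abel

theorem reduction_eq {V E : Type} [Fintype V] [Fintype E] (ends : E → V × V) (w : E → ℚ)
    (G : E → Fin 4 → (V ⊕ Fin 3) × (V ⊕ Fin 3)) (x : E → Fin 3 → ℚ)
    (h : ∀ e, ∑ A : Finset (Fin 4), sg (fun v => dg (G e) A (Sum.inl v))
        (∏ i, gg (x e i) (dg (G e) A (Sum.inr i)))
        = 1 + sg (fun v => ind (Inc ends v e)) (w e)) :
    perfMatch ends w = matchSum (V := V ⊕ E × Fin 3) (E := E × Fin 4)
      (fun p => (Sum.map id (Prod.mk p.1) (G p.1 p.2).1, Sum.map id (Prod.mk p.1) (G p.1 p.2).2))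
      (Sum.elim (fun _ => 0) fun p => x p.1 p.2) := by
  have sgprod : ∀ (s : Finset E) (b : E → V → ℕ) (q : E → ℚ),
      ∏ e ∈ s, sg (b e) (q e) = sg (∑ e ∈ s, b e) (∏ e ∈ s, q e) := by
    intro s b q
    induction s using Finset.induction_on with
    | empty => rfl
    | insert a s ha ih =>
      rw [Finset.prod_insert ha, Finset.sum_insert ha, Finset.prod_insert ha, ih]
      exact AddMonoidAlgebra.single_mul_single ..
  have hp := Finset.prod_congr (rfl : (Finset.univ : Finset E) = Finset.univ) fun e _ => h e
  rw [Finset.prod_univ_sum, Finset.prod_one_add] at hp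
  simp only [sgprod] at hp
  let Φ : Alg V →+ ℚ := (Finsupp.liftAddHom fun b : V → ℕ =>
    AddMonoidHom.mulRight (∏ v, gg 0 (b v))).comp AddMonoidAlgebra.coeffAddEquiv.toAddMonoidHom
  have hΦ : ∀ b q, Φ (sg b q) = q * ∏ v, gg 0 (b v) := by
    intro b q
    change (Finsupp.liftAddHom fun b : V → ℕ =>
      AddMonoidHom.mulRight (∏ v, gg 0 (b v))) (Finsupp.single b q) = _
    simp
  have hq := congrArg Φ hp
  simp only [map_sum, hΦ, Finset.sum_apply, Fintype.piFinset_univ, Finset.powerset_univ] at hq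
  rw [perfMatch_eq, matchSum_eq]
  simp only [dg] at hq ⊢
  rw [← hq]
  let F : (E → Finset (Fin 4)) ≃ Finset (E × Fin 4) :=
    { toFun := fun A => Finset.univ.filter fun p => p.2 ∈ A p.1
      invFun := fun M e => Finset.univ.filter fun j => (e, j) ∈ M
      left_inv := fun A => by ext; simp
      right_inv := fun M => by ext; simp }
  rw [← F.sum_comp]
  refine Finset.sum_congr rfl fun A _ => ?_
  have hF : ∀ f : E × Fin 4 → ℕ, ∑ p ∈ F A, f p = ∑ e, ∑ j ∈ A e, f (e, j) := by
    intro f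
    simp only [F, Equiv.coe_fn_mk]
    rw [Finset.sum_filter, Fintype.sum_prod_type]
    refine Finset.sum_congr rfl fun e _ => ?_
    simp only [← Finset.sum_filter, Finset.filter_mem_eq_inter, Finset.univ_inter]
  simp only [hF]
  rw [Fintype.prod_sum_type, Fintype.prod_prod_type, mul_comm]
  have hl : ∀ (v : V) (e : E) (y : V ⊕ Fin 3),
      (Sum.inl v = Sum.map id (Prod.mk e) y) ↔ Sum.inl v = y := by
    intro v e y; cases y <;> simp
  have hr : ∀ (e' : E) (i : Fin 3) (e : E) (y : V ⊕ Fin 3),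
      (Sum.inr (e', i) = Sum.map id (Prod.mk e) y) ↔ e' = e ∧ Sum.inr i = y := by
    intro e' i e y; cases y <;> simp
  congr 1
  · simp only [Inc, hl, Sum.elim_inl]
  · refine Finset.prod_congr rfl fun e _ => Finset.prod_congr rfl fun i _ => ?_
    simp only [Inc, hr, Sum.elim_inr]
    congr 1
    rw [Finset.sum_eq_single e]
    · simp
    · intro e' _ hne
      simp [hne.symm, ind_false]
    · simp

/-- For every graph `G` on `n` vertices and `m` edges with edge weights in `{-1, 1}`,
there is a graph `G'` with at most `C * (n + m)` vertices and edges (for an absolute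
constant `C`), with vertex weights in `{-1, 0, 1}`, such that
`PerfMatch G = MatchSum G'`. -/
theorem perfMatch_to_matchSum :
    ∃ C : ℕ, ∀ (V E : Type) [Fintype V] [Fintype E]
      (ends : E → V × V) (w : E → ℚ),
      (∀ e, w e = 1 ∨ w e = -1) →
      ∃ (N M : ℕ) (ends' : Fin M → Fin N × Fin N) (wv : Fin N → ℚ),
        N ≤ C * (Fintype.card V + Fintype.card E) ∧
        M ≤ C * (Fintype.card V + Fintype.card E) ∧
        (∀ v, wv v = -1 ∨ wv v = 0 ∨ wv v = 1) ∧
        perfMatch ends w = matchSum ends' wv := by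
  refine ⟨4, fun V E _ _ ends w hw => ?_⟩
  choose G x hx h using fun e => gadget ends w e (hw e)
  refine ⟨Fintype.card (V ⊕ E × Fin 3), Fintype.card (E × Fin 4), _, _, ?_, ?_, ?_,
    (reduction_eq ends w G x h).trans
      (matchSum_equiv _ _ (Fintype.equivFin _).symm (Fintype.equivFin _).symm).symm⟩
  · simp only [Fintype.card_sum, Fintype.card_prod, Fintype.card_fin]
    omega
  · simp only [Fintype.card_prod, Fintype.card_fin]
    omega
  · intro v
    rcases (Fintype.equivFin (V ⊕ E × Fin 3)).symm v with a | p
    · simp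
    · exact hx p.1 p.2
end

section
/- Let G be a finite graph on n vertices and m edges with edge weights w : E(G) → ℕ (nonnegative integers), and let W = max_{e ∈ E(G)} w(e). Then there exists an unweighted simple graph G′ with at most C·(n + W·m) vertices and edges (for an absolute constant C) such that the number of perfect matchings of G′ equals PerfMatch(G). -/
open scoped Classical

set_option linter.unusedSimpArgs false

/-- exact cover count -/
noncomputable def cnt : List (Finset ℕ) → Finset ℕ → ℕ
  | [], S => if S = ∅ then 1 else 0
  | e :: L, S => cnt L S + if e ⊆ S then cnt L (S \ e) else 0

lemma cnt_zero (L : List (Finset ℕ)) : ∀ (S : Finset ℕ) (a : ℕ), a ∈ S → (∀ e ∈ L, a ∉ e) →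
    cnt L S = 0 := by
  induction L with
  | nil => intro S a ha _; simp [cnt, Finset.ne_empty_of_mem ha]
  | cons e L ih =>
    intro S a ha h
    have h1 := ih S a ha (fun e he => h e (by simp [he]))
    have h2 := ih (S \ e) a (by simp [ha, h e]) (fun e he => h e (by simp [he]))
    simp [cnt, h1, h2]

lemma cnt_perm {L L' : List (Finset ℕ)} (h : L.Perm L') : ∀ S, cnt L S = cnt L' S := by
  induction h with
  | nil => intro S; rfl
  | cons e _ ih => intro S; simp [cnt, ih]
  | trans _ _ ih1 ih2 => intro S; rw [ih1, ih2]
  | swap a b L =>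
    intro S
    simp only [cnt, Finset.subset_sdiff, sdiff_right_comm S a b, disjoint_comm (a := a)]
    split_ifs <;> first | omega | (exfalso; tauto)

lemma cnt_odd (L : List (Finset ℕ)) : ∀ (S : Finset ℕ), (∀ e ∈ L, e.card = 2) → Odd S.card →
    cnt L S = 0 := by
  induction L with
  | nil =>
    intro S _ h
    have : S ≠ ∅ := by rintro rfl; simp at h
    simp [cnt, this]
  | cons e L ih =>
    intro S h ho
    have h1 := ih S (fun e he => h e (by simp [he])) ho
    simp only [cnt, h1, zero_add, ite_eq_right_iff]
    intro hs
    apply ih _ (fun e he => h e (by simp [he]))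
    have h2 := Finset.card_sdiff_add_card_eq_card hs
    have := h e (by simp)
    rw [← h2, this] at ho
    rw [Nat.odd_iff] at *
    omega

lemma gadget_edge (L : List (Finset ℕ)) (N u v : ℕ) (hu : u < N) (hv : v < N) (huv : u ≠ v)
    (hL : ∀ e ∈ L, e ⊆ Finset.range N) :
    cnt ({u, N} :: {N, N+1} :: {N+1, v} :: L) (Finset.range (N+2)) =
      cnt ({u, v} :: L) (Finset.range N) := by
  have h0 : ∀ T, N ∈ T → cnt L T = 0 := fun T hT => cnt_zero L T N hT
    (fun e he h => by simpa using hL e he h)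
  have h1 : ∀ T, N + 1 ∈ T → cnt L T = 0 := fun T hT => cnt_zero L T (N+1) hT
    (fun e he h => by simpa using hL e he h)
  have a1 : N ≠ u := by omega
  have a2 : N ≠ v := by omega
  have a3 : N + 1 ≠ u := by omega
  have a4 : N + 1 ≠ v := by omega
  have a5 : u < N + 2 := by omega
  have a6 : v < N + 2 := by omega
  simp [cnt, Finset.insert_subset_iff, h0, h1, a1, a2, a3, a4, a5, a6, a1.symm, a2.symm, a3.symm,
    a4.symm, hu, hv, huv, huv.symm]
  congr 2
  · ext x; simp; omega
  · ext x; simp; omega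

lemma gadget_loop (L : List (Finset ℕ)) (N u t : ℕ) (hu : u < N) (ht : t < N)
    (hL : ∀ e ∈ L, e ⊆ Finset.range N) :
    cnt ({N+2} :: {N+1, N+2} :: {N, N+2} :: {N, N+1} :: {u, N} :: {t, N+1} :: L)
      (Finset.range (N+3)) =
      cnt ({u} :: {t} :: L) (Finset.range N) := by
  have h0 : ∀ T, N ∈ T → cnt L T = 0 := fun T hT => cnt_zero L T N hT
    (fun e he h => by simpa using hL e he h)
  have h1 : ∀ T, N + 1 ∈ T → cnt L T = 0 := fun T hT => cnt_zero L T (N+1) hT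
    (fun e he h => by simpa using hL e he h)
  have h2 : ∀ T, N + 2 ∈ T → cnt L T = 0 := fun T hT => cnt_zero L T (N+2) hT
    (fun e he h => by simpa using hL e he h)
  have a1 : N ≠ u := by omega
  have a2 : N ≠ t := by omega
  have a3 : N + 1 ≠ u := by omega
  have a4 : N + 1 ≠ t := by omega
  have a5 : u < N + 3 := by omega
  have a6 : t < N + 3 := by omega
  have a7 : N + 2 ≠ u := by omega
  have a8 : N + 2 ≠ t := by omega
  simp [cnt, Finset.insert_subset_iff, h0, h1, h2, a1, a2, a3, a4, a5, a6, a1.symm, a2.symm,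
    a3.symm, a4.symm, a7, a8, a7.symm, a8.symm, hu, ht]
  have e1 : (Finset.range (N + 3) \ {N, N + 2}) \ {t, N + 1} = Finset.range N \ {t} := by
    ext x; simp; omega
  have e2 : (Finset.range (N + 3) \ {N + 1, N + 2}) \ {u, N} = Finset.range N \ {u} := by
    ext x; simp; omega
  have e3 : ((Finset.range (N + 3) \ {N + 2}) \ {u, N}) \ {t, N + 1} =
      (Finset.range N \ {u}) \ {t} := by
    ext x; simp; omega
  have e4 : (Finset.range (N + 3) \ {N + 2}) \ {N, N + 1} = Finset.range N := by
    ext x; simp; omega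
  rw [e1, e2, e3, e4]
  omega

lemma gadget_init (L : List (Finset ℕ)) (N : ℕ) 
    (hL : ∀ e ∈ L, e ⊆ Finset.range N) :
    cnt ({N} :: L) (Finset.range (N+1)) = cnt L (Finset.range N) := by
  have h0 : ∀ T, N ∈ T → cnt L T = 0 := fun T hT => cnt_zero L T N hT
    (fun e he h => by simpa using hL e he h)
  simp [cnt, h0]
  congr 1; ext x; simp; omega

lemma gadget_final (L : List (Finset ℕ)) (N t : ℕ) (ht : t < N) (ho : Odd N)
    (hL : ∀ e ∈ L, e ⊆ Finset.range N) (h2 : ∀ e ∈ L, e.card = 2) :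
    cnt ({t, N} :: L) (Finset.range (N+1)) = cnt ({t} :: L) (Finset.range N) := by
  have h0 : ∀ T, N ∈ T → cnt L T = 0 := fun T hT => cnt_zero L T N hT
    (fun e he h => by simpa using hL e he h)
  have h3 : cnt L (Finset.range N) = 0 := cnt_odd L _ h2 (by simpa)
  have a : t < N + 1 := by omega
  simp [cnt, h0, h3, Finset.insert_subset_iff, ht, a]
  congr 1; ext x; simp; omega

lemma gadget_final' (L : List (Finset ℕ)) (N t : ℕ) (ht : t < N) (ho : Even N)
    (h2 : ∀ e ∈ L, e.card = 2) :
    cnt L (Finset.range N) = cnt ({t} :: L) (Finset.range N) := by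
  have h3 : cnt L (Finset.range N \ {t}) = 0 := by
    apply cnt_odd L _ h2
    rw [Finset.card_sdiff_of_subset (by simpa)]
    simp
    exact Nat.Even.sub_odd (by omega) ho (by simp)
  simp [cnt, h3]

lemma process (P : List (Finset ℕ)) : ∀ (N t : ℕ) (D : List (Finset ℕ)), t < N →
    (∀ e ∈ P, e ⊆ Finset.range N ∧ ∃ u v, e = {u, v}) → D.Nodup →
    (∀ e ∈ D, e ⊆ Finset.range N) → (∀ e ∈ D, e.card = 2) →
    ∃ (N' : ℕ) (D' : List (Finset ℕ)), N' ≤ N + 3 * P.length + 1 ∧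
      D'.length ≤ D.length + 5 * P.length + 1 ∧ D'.Nodup ∧ (∀ e ∈ D', e ⊆ Finset.range N') ∧
      (∀ e ∈ D', e.card = 2) ∧
      cnt D' (Finset.range N') = cnt ({t} :: (P ++ D)) (Finset.range N) := by
  induction P with
  | nil =>
    intro N t D ht _ hD hr h2
    rcases Nat.even_or_odd N with he | ho
    · exact ⟨N, D, by simp, by simp, hD, hr, h2, gadget_final' D N t ht he h2⟩
    · refine ⟨N+1, {t, N} :: D, by simp, by simp, ?_, ?_, ?_, gadget_final D N t ht ho hr h2⟩
      · refine List.nodup_cons.2 ⟨fun h => ?_, hD⟩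
        have := hr _ h (show N ∈ _ by simp)
        simp at this
      · intro e he
        rcases List.mem_cons.1 he with rfl | he
        · intro x; simp; omega
        · exact (hr e he).trans (Finset.range_mono (by omega))
      · intro e he
        rcases List.mem_cons.1 he with rfl | he
        · exact Finset.card_pair (by omega)
        · exact h2 e he
  | cons e P ih =>
    intro N t D ht hP hD hr h2
    obtain ⟨hes, u, v, rfl⟩ := hP e (by simp)
    have hu : u < N := by simpa using hes (show u ∈ _ by simp)
    have hv : v < N := by simpa using hes (show v ∈ _ by simp)
    have hn : ∀ e ∈ D, ∀ k, N + k ∉ e := fun e he k hk => by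
      simpa using hr e he hk
    have hn' : ∀ e ∈ D, N ∉ e := fun e he hk => by
      simpa using hr e he hk
    have hLr : ∀ e ∈ P ++ D, e ⊆ Finset.range N := by
      intro e he
      rcases List.mem_append.1 he with he | he
      · exact (hP e (by simp [he])).1
      · exact hr e he
    by_cases huv : u = v
    · subst huv
      obtain ⟨N', D', b1, b2, b3, b4, b5, b6⟩ := ih (N+3) (N+2)
        ({N+1, N+2} :: {N, N+2} :: {N, N+1} :: {u, N} :: {t, N+1} :: D) (by omega)
        (fun e he => ⟨((hP e (by simp [he])).1).trans (Finset.range_mono (by omega)),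
          (hP e (by simp [he])).2⟩) 
        (by
          have ne : ∀ (a b c d : ℕ), a ≠ c → a ≠ d → ({a, b} : Finset ℕ) ≠ {c, d} := by
            intro a b c d h1 h2 h
            have := h ▸ (show a ∈ ({a, b} : Finset ℕ) by simp)
            simp [h1, h2] at this
          have ne' : ∀ (a b c d : ℕ), b ≠ c → b ≠ d → ({a, b} : Finset ℕ) ≠ {c, d} := by
            intro a b c d h1 h2 h
            have := h ▸ (show b ∈ ({a, b} : Finset ℕ) by simp)
            simp [h1, h2] at this
          have nd : ∀ e : Finset ℕ, ∀ k, N + k ∈ e → e ∉ D := fun e k hk he => hn e he k hk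
          have nd' : ∀ e : Finset ℕ, N ∈ e → e ∉ D := fun e hk he => hn' e he hk
          simp only [List.nodup_cons, List.mem_cons, not_or]
          refine ⟨⟨?_, ?_, ?_, ?_, ?_⟩, ⟨?_, ?_, ?_, ?_⟩, ⟨?_, ?_, ?_⟩, ⟨?_, ?_⟩, ?_, ?_⟩
          all_goals first
            | exact hD
            | (refine nd' _ ?_; simp; done)
            | (refine nd _ 1 ?_; simp; done)
            | (refine ne _ _ _ _ ?_ ?_ <;> omega)
            | (refine ne' _ _ _ _ ?_ ?_ <;> omega))
        (by
          intro e he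
          simp only [List.mem_cons] at he
          rcases he with rfl | rfl | rfl | rfl | rfl | he
          iterate 5 (intro x; simp; omega)
          exact (hr e he).trans (Finset.range_mono (by omega)))
        (by
          intro e he
          simp only [List.mem_cons] at he
          rcases he with rfl | rfl | rfl | rfl | rfl | he
          iterate 5 exact Finset.card_pair (by omega)
          exact h2 e he)
      refine ⟨N', D', ?_, ?_, b3, b4, b5, ?_⟩
      · simp at *; omega
      · simp at *; omega
      · rw [b6]
        have e1 := gadget_loop (P ++ D) N u t hu ht hLr
        have e2 : ({t} :: (({u, u} :: P) ++ D)).Perm ({u} :: {t} :: (P ++ D)) := by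
          simp [List.Perm.swap]
        rw [cnt_perm e2, ← e1]
        apply cnt_perm
        apply List.Perm.cons
        exact List.perm_append_comm_assoc P 
          [{N+1, N+2}, {N, N+2}, {N, N+1}, {u, N}, {t, N+1}] D
    · obtain ⟨N', D', b1, b2, b3, b4, b5, b6⟩ := ih (N+2) t
        ({u, N} :: {N, N+1} :: {N+1, v} :: D) (by omega)
        (fun e he => ⟨((hP e (by simp [he])).1).trans (Finset.range_mono (by omega)),
          (hP e (by simp [he])).2⟩) 
        (by
          have ne : ∀ (a b c d : ℕ), a ≠ c → a ≠ d → ({a, b} : Finset ℕ) ≠ {c, d} := by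
            intro a b c d h1 h2 h
            have := h ▸ (show a ∈ ({a, b} : Finset ℕ) by simp)
            simp [h1, h2] at this
          have ne' : ∀ (a b c d : ℕ), b ≠ c → b ≠ d → ({a, b} : Finset ℕ) ≠ {c, d} := by
            intro a b c d h1 h2 h
            have := h ▸ (show b ∈ ({a, b} : Finset ℕ) by simp)
            simp [h1, h2] at this
          have nd : ∀ e : Finset ℕ, ∀ k, N + k ∈ e → e ∉ D := fun e k hk he => hn e he k hk
          have nd' : ∀ e : Finset ℕ, N ∈ e → e ∉ D := fun e hk he => hn' e he hk
          simp only [List.nodup_cons, List.mem_cons, not_or]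
          refine ⟨⟨?_, ?_, ?_⟩, ⟨?_, ?_⟩, ?_, ?_⟩
          all_goals first
            | exact hD
            | (refine nd' _ ?_; simp; done)
            | (refine nd _ 1 ?_; simp; done)
            | (refine ne _ _ _ _ ?_ ?_ <;> omega)
            | (refine ne' _ _ _ _ ?_ ?_ <;> omega))
        (by
          intro e he
          simp only [List.mem_cons] at he
          rcases he with rfl | rfl | rfl | he
          iterate 3 (intro x; simp; omega)
          exact (hr e he).trans (Finset.range_mono (by omega)))
        (by
          intro e he
          simp only [List.mem_cons] at he
          rcases he with rfl | rfl | rfl | he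
          iterate 3 exact Finset.card_pair (by omega)
          exact h2 e he)
      refine ⟨N', D', ?_, ?_, b3, b4, b5, ?_⟩
      · simp at *; omega
      · simp at *; omega
      · rw [b6]
        have e1 := gadget_edge ({t} :: (P ++ D)) N u v hu hv huv (by
          intro e he
          rcases List.mem_cons.1 he with rfl | he
          · simpa
          · exact hLr e he)
        have e2 : ({t} :: (({u, v} :: P) ++ D)).Perm ({u, v} :: {t} :: (P ++ D)) := by
          simp [List.Perm.swap]
        rw [cnt_perm e2, ← e1]
        apply cnt_perm
        have q1 := List.Perm.cons {t} (List.perm_append_comm_assoc P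
          [{u, N}, {N, N+1}, {N+1, v}] D)
        have q2 := List.perm_append_comm_assoc [({t} : Finset ℕ)]
          [{u, N}, {N, N+1}, {N+1, v}] (P ++ D)
        exact q1.trans q2

lemma cnt_replicate (e : Finset ℕ) (he : e.Nonempty) (L : List (Finset ℕ)) (k : ℕ) :
    ∀ S, cnt (List.replicate k e ++ L) S =
      cnt L S + k * if e ⊆ S then cnt L (S \ e) else 0 := by
  induction k with
  | zero => intro S; simp
  | succ k ih =>
    intro S
    have : ¬ e ⊆ S \ e := by
      obtain ⟨x, hx⟩ := he
      intro h
      have := h hx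
      simp [hx] at this
    simp only [List.replicate_succ, List.cons_append, cnt, ih, this, if_false]
    split_ifs <;> ring

lemma cover_sum {E : Type} (f : E → Finset ℕ) (hf : ∀ e, (f e).Nonempty) (w : E → ℕ)
    (l : List E) : l.Nodup → ∀ S : Finset ℕ,
    ∑ M ∈ l.toFinset.powerset, (if ∑ e ∈ M, (f e).val = S.val then ∏ e ∈ M, w e else 0) =
      cnt (l.flatMap (fun e => List.replicate (w e) (f e))) S := by
  induction l with
  | nil =>
    intro _ S
    have : (0 : Multiset ℕ) = S.val ↔ S = ∅ := by
      rw [eq_comm, Finset.val_eq_zero]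
    simp [cnt, this]
  | cons a l ih =>
    intro hnd S
    obtain ⟨ha, hl⟩ := List.nodup_cons.1 hnd
    have ha' : a ∉ l.toFinset := by simpa using ha
    rw [List.toFinset_cons, Finset.sum_powerset_insert ha', ih hl S, List.flatMap_cons,
      cnt_replicate _ (hf a)]
    congr 1
    have key : ∀ M ∈ l.toFinset.powerset,
        (if ∑ e ∈ insert a M, (f e).val = S.val then ∏ e ∈ insert a M, w e else 0) =
        w a * (if f a ⊆ S then
          (if ∑ e ∈ M, (f e).val = (S \ f a).val then ∏ e ∈ M, w e else 0) else 0) := by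
      intro M hM
      have haM : a ∉ M := fun h => ha' (Finset.mem_powerset.1 hM h)
      rw [Finset.sum_insert haM, Finset.prod_insert haM]
      by_cases hs : f a ⊆ S
      · have : (f a).val + ∑ e ∈ M, (f e).val = S.val ↔
            ∑ e ∈ M, (f e).val = (S \ f a).val := by
          have h1 : S.val = (f a).val + (S \ f a).val := by
            rw [Finset.sdiff_val, add_tsub_cancel_of_le (Finset.val_le_iff.2 hs)]
          rw [h1, add_right_inj]
        simp [this, hs]
      · have : ¬ ((f a).val + ∑ e ∈ M, (f e).val = S.val) := by
          intro h
          apply hs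
          rw [← Finset.val_le_iff, ← h]
          exact Multiset.le_add_right _ _
        simp [this, hs]
    rw [Finset.sum_congr rfl key, ← Finset.mul_sum]
    congr 1
    split_ifs
    · exact ih hl _
    · simp

lemma exact_iff {E : Type} (f : E → Finset ℕ) (S : Finset ℕ) (M : Finset E)
    (h : ∀ e ∈ M, f e ⊆ S) :
    ∑ e ∈ M, (f e).val = S.val ↔ ∀ x ∈ S, ∃! e, e ∈ M ∧ x ∈ f e := by
  have h1 : ∀ x, Multiset.count x (∑ e ∈ M, (f e).val) = (M.filter (fun e => x ∈ f e)).card := by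
    intro x
    rw [Multiset.count_sum', Finset.card_filter]
    apply Finset.sum_congr rfl
    intro e _
    rw [Multiset.count_eq_of_nodup (f e).nodup]
    rfl
  have h2 : ∀ x, (M.filter (fun e => x ∈ f e)).card = 1 ↔ ∃! e, e ∈ M ∧ x ∈ f e := by
    intro x
    rw [Finset.card_eq_one, Finset.singleton_iff_unique_mem]
    simp
  rw [Multiset.ext]
  constructor
  · intro H x hx
    rw [← h2, ← h1, H, Multiset.count_eq_one_of_mem S.nodup hx]
  · intro H x
    by_cases hx : x ∈ S
    · rw [h1, (h2 x).2 (H x hx), Multiset.count_eq_one_of_mem S.nodup hx]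
    · rw [h1, Multiset.count_eq_zero_of_notMem hx, Finset.card_eq_zero, Finset.filter_eq_empty_iff]
      exact fun e he hxe => hx (h e he hxe)

/-- simple graph of an edge list -/
def listGraph (N : ℕ) (D : List (Finset ℕ)) : SimpleGraph (Fin N) where
  Adj u v := u ≠ v ∧ ({u.val, v.val} : Finset ℕ) ∈ D
  symm := ⟨fun u v h => ⟨h.1.symm, by rw [Finset.pair_comm]; exact h.2⟩⟩
  loopless := ⟨fun u h => h.1 rfl⟩

lemma pair_fin {N : ℕ} {u v : Fin N} {a b : Fin N}
    (h : ({u.val, v.val} : Finset ℕ) = {a.val, b.val}) : (u = a ∧ v = b) ∨ (u = b ∧ v = a) := by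
  have h1 := (Finset.ext_iff.1 h u.val)
  have h2 := (Finset.ext_iff.1 h v.val)
  have h3 := (Finset.ext_iff.1 h a.val)
  have h4 := (Finset.ext_iff.1 h b.val)
  simp at h1 h2 h3 h4
  simp only [Fin.ext_iff]
  omega

lemma listGraph_edges (N : ℕ) (D : List (Finset ℕ)) :
    Nat.card (listGraph N D).edgeSet ≤ D.length := by
  have hf : ∀ e : (listGraph N D).edgeSet, ∃ u v : Fin N, e.1 = s(u, v) ∧
      ({u.val, v.val} : Finset ℕ) ∈ D := by
    rintro ⟨e, he⟩
    induction e with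
    | _ u v => exact ⟨u, v, rfl, he.2⟩
  choose p q h1 h2 using hf
  have := Nat.card_le_card_of_injective
    (fun e : (listGraph N D).edgeSet => (⟨{(p e).val, (q e).val}, by simpa using h2 e⟩ :
      {x // x ∈ D.toFinset})) (by
      intro a b hab
      have := pair_fin (Subtype.ext_iff.1 hab)
      apply Subtype.ext
      rw [h1, h1]
      rcases this with ⟨h, h'⟩ | ⟨h, h'⟩
      · rw [h, h']
      · rw [h, h', Sym2.eq_swap])
  refine this.trans ?_
  rw [Nat.card_eq_finsetCard]
  exact List.toFinset_card_le D

lemma listGraph_numPM (N : ℕ) (D : List (Finset ℕ)) (hD : D.Nodup)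
    (hr : ∀ e ∈ D, e ⊆ Finset.range N) (h2 : ∀ e ∈ D, e.card = 2) :
    numPM (listGraph N D) = cnt D (Finset.range N) := by
  have hpair : ∀ e ∈ D, ∃ u v : Fin N, u ≠ v ∧ e = {u.val, v.val} := by
    intro e he
    obtain ⟨x, y, hxy, rfl⟩ := Finset.card_eq_two.1 (h2 e he)
    have hx := hr _ he (show x ∈ _ by simp)
    have hy := hr _ he (show y ∈ _ by simp)
    simp at hx hy
    exact ⟨⟨x, hx⟩, ⟨y, hy⟩, by simpa using hxy, rfl⟩
  have c1 : cnt D (Finset.range N) = (D.toFinset.powerset.filter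
      (fun M => ∑ e ∈ M, e.val = (Finset.range N).val)).card := by
    -- use attach-free version with nonempty edges
    have hne : ∀ e ∈ D, e.Nonempty := fun e he => by
      rw [← Finset.card_pos, h2 e he]; norm_num
    let g : Finset ℕ → Finset ℕ := fun e => if e.Nonempty then e else {0}
    have hg : ∀ e ∈ D, g e = e := fun e he => by simp [g, hne e he]
    have := cover_sum g (fun e => by by_cases h : e.Nonempty <;> simp [g, h]) (fun _ => 1) D hD
      (Finset.range N)
    have hfl : D.flatMap (fun e => List.replicate 1 (g e)) = D := by
      have h3 : ∀ l : List (Finset ℕ), (∀ e ∈ l, g e = e) →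
          l.flatMap (fun e => List.replicate 1 (g e)) = l := by
        intro l
        induction l with
        | nil => simp
        | cons a l ih =>
          intro h
          rw [List.flatMap_cons, ih (fun e he => h e (by simp [he])), h a (by simp)]
          simp
      exact h3 D hg
    rw [hfl] at this
    rw [← this, Finset.card_filter]
    refine Finset.sum_congr (by ext; simp [Finset.subset_iff]) ?_
    intro M hM
    have : ∑ e ∈ M, (g e).val = ∑ e ∈ M, e.val := Finset.sum_congr rfl (fun e he => by
      rw [hg e (by simpa using Finset.mem_powerset.1 hM he)])
    rw [this, Finset.prod_const_one]
  rw [c1, numPM, ← Nat.card_eq_finsetCard]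
  symm
  let F : Finset (Finset ℕ) → (listGraph N D).Subgraph := fun M =>
    { verts := Set.univ
      Adj := fun u v => u ≠ v ∧ ({u.val, v.val} : Finset ℕ) ∈ D ∧ ({u.val, v.val} : Finset ℕ) ∈ M
      adj_sub := fun h => ⟨h.1, h.2.1⟩
      edge_vert := fun _ => trivial
      symm := ⟨fun u v h => ⟨h.1.symm, by rw [Finset.pair_comm]; exact h.2⟩⟩ }
  have hF : ∀ M ⊆ D.toFinset, (F M).IsPerfectMatching ↔
      ∑ e ∈ M, e.val = (Finset.range N).val := by
    intro M hM
    have hMD : ∀ e ∈ M, e ∈ D := fun e he => by simpa using hM he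
    rw [exact_iff (fun e => e) (Finset.range N) M (fun e he => hr e (hMD e he)),
      SimpleGraph.Subgraph.isPerfectMatching_iff]
    constructor
    · intro H x hx
      obtain ⟨y, hy, hu⟩ := H ⟨x, by simpa using hx⟩
      refine ⟨{x, y.val}, ⟨hy.2.2, by simp⟩, ?_⟩
      rintro e ⟨he, hxe⟩
      obtain ⟨a, b, hab, rfl⟩ := hpair e (hMD e he)
      simp at hxe
      rcases hxe with rfl | rfl
      · rw [hu b ⟨hab, hMD _ he, he⟩]
      · rw [hu a ⟨hab.symm, by rw [Finset.pair_comm]; exact ⟨hMD _ he, he⟩⟩, Finset.pair_comm]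
    · intro H v
      obtain ⟨e, ⟨he, hve⟩, hu⟩ := H v.val (by simp)
      have ex : ∃ b : Fin N, v ≠ b ∧ e = {v.val, b.val} := by
        obtain ⟨a, b, hab, rfl⟩ := hpair e (hMD e he)
        simp only [Finset.mem_insert, Finset.mem_singleton, ← Fin.ext_iff] at hve
        rcases hve with rfl | rfl
        · exact ⟨b, hab, rfl⟩
        · exact ⟨a, hab.symm, Finset.pair_comm _ _⟩
      obtain ⟨b, hb, rfl⟩ := ex
      refine ⟨b, ⟨hb, hMD _ he, he⟩, ?_⟩
      intro c hc
      have := pair_fin (hu _ ⟨hc.2.2, by simp⟩)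
      rcases this with ⟨_, h⟩ | ⟨h, _⟩
      · exact h
      · exact absurd h hb
  refine Nat.card_eq_of_bijective (fun M => ⟨F M.1, ?_⟩) ⟨?_, ?_⟩
  · have := M.2
    rw [Finset.mem_filter, Finset.mem_powerset] at this
    exact (hF _ this.1).2 this.2
  · intro M M' h
    have hFF : F M.1 = F M'.1 := Subtype.ext_iff.1 h
    have hs : ∀ M : {x // x ∈ D.toFinset.powerset.filter
      (fun M => ∑ e ∈ M, e.val = (Finset.range N).val)}, M.1 ⊆ D.toFinset := fun M => by
      have := M.2
      rw [Finset.mem_filter, Finset.mem_powerset] at this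
      exact this.1
    have sub : ∀ A B : Finset (Finset ℕ), A ⊆ D.toFinset → F A = F B → A ⊆ B := by
      intro A B hA hAB e he
      have heD : e ∈ D := by simpa using hA he
      obtain ⟨a, b, hab, rfl⟩ := hpair e heD
      have : (F A).Adj a b := ⟨hab, heD, he⟩
      rw [hAB] at this
      exact this.2.2
    exact Subtype.ext (Finset.Subset.antisymm (sub _ _ (hs M) hFF) (sub _ _ (hs M') hFF.symm))
  · rintro ⟨H, hH⟩
    let M : Finset (Finset ℕ) := D.toFinset.filter
      (fun e => ∃ u v : Fin N, H.Adj u v ∧ e = {u.val, v.val})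
    have hMs : M ⊆ D.toFinset := Finset.filter_subset _ _
    have hFM : F M = H := by
      apply SimpleGraph.Subgraph.ext
      · exact (SimpleGraph.Subgraph.isSpanning_iff.1 hH.2).symm
      · ext u v
        constructor
        · rintro ⟨_, _, h⟩
          obtain ⟨a, b, hab, h⟩ := (Finset.mem_filter.1 h).2
          rcases pair_fin h with ⟨rfl, rfl⟩ | ⟨rfl, rfl⟩
          · exact hab
          · exact hab.symm
        · intro h
          have h' := H.adj_sub h
          exact ⟨h'.1, h'.2, Finset.mem_filter.2 ⟨by simpa using h'.2, u, v, h, rfl⟩⟩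
    refine ⟨⟨M, ?_⟩, Subtype.ext hFM⟩
    rw [Finset.mem_filter, Finset.mem_powerset]
    exact ⟨hMs, (hF M hMs).1 (hFM ▸ hH)⟩

lemma start {V E : Type} [Fintype V] [Fintype E] (ends : E → V × V) (w : E → ℕ) :
    ∃ P : List (Finset ℕ), P.length ≤ Finset.univ.sup w * Fintype.card E ∧
      (∀ e ∈ P, e ⊆ Finset.range (Fintype.card V) ∧ ∃ u v, e = {u, v}) ∧
      perfMatch ends (fun e => (w e : ℚ)) = cnt P (Finset.range (Fintype.card V)) := by
  let φ := Fintype.equivFin V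
  let f : E → Finset ℕ := fun e => {(φ (ends e).1).val, (φ (ends e).2).val}
  have hfs : ∀ e, f e ⊆ Finset.range (Fintype.card V) := by
    intro e x hx
    simp only [f, Finset.mem_insert, Finset.mem_singleton] at hx
    rcases hx with rfl | rfl <;> simp
  refine ⟨(Finset.univ : Finset E).toList.flatMap (fun e => List.replicate (w e) (f e)),
    ?_, ?_, ?_⟩
  · rw [List.length_flatMap]
    simp only [List.length_replicate]
    rw [Finset.sum_map_toList]
    have := Finset.sum_le_card_nsmul (Finset.univ : Finset E) w (Finset.univ.sup w)
      (fun e he => Finset.le_sup he)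
    simpa [mul_comm] using this
  · intro e he
    obtain ⟨a, _, ha⟩ := List.mem_flatMap.1 he
    obtain ⟨_, rfl⟩ := List.mem_replicate.1 ha
    exact ⟨hfs a, _, _, rfl⟩
  · have := cover_sum f (fun e => by simp [f]) w (Finset.univ : Finset E).toList
      (Finset.nodup_toList _) (Finset.range (Fintype.card V))
    rw [← this, perfMatch, Finset.sum_filter, Finset.toList_toFinset, Finset.powerset_univ]
    push_cast
    apply Finset.sum_congr rfl
    intro M _
    have : IsPM ends M ↔ ∑ e ∈ M, (f e).val = (Finset.range (Fintype.card V)).val := by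
      rw [exact_iff f _ M (fun e _ => hfs e)]
      have hinc : ∀ v e, (φ v).val ∈ f e ↔ Inc ends v e := by
        intro v e
        simp [f, Inc, ← Fin.ext_iff]
      constructor
      · intro H x hx
        have := H (φ.symm ⟨x, by simpa using hx⟩)
        simp only [← hinc] at this
        simpa using this
      · intro H v
        have := H (φ v).val (by simp)
        simpa only [hinc] using this
    by_cases h : IsPM ends M
    · rw [if_pos h, if_pos (this.1 h)]
    · rw [if_neg h, if_neg (fun h' => h (this.2 h'))]

/-- For every graph `G` on `n` vertices and `m` edges with nonnegative integer edge
weights and maximum weight `W`, there is an unweighted simple graph `G'` on at most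
`C * (n + W * m)` vertices and edges (for an absolute constant `C`) whose number of
perfect matchings equals `PerfMatch G`. -/
theorem nat_weight_removal :
    ∃ C : ℕ, ∀ (V E : Type) [Fintype V] [Fintype E]
      (ends : E → V × V) (w : E → ℕ),
      let W : ℕ := Finset.univ.sup w
      ∃ (N : ℕ) (G' : SimpleGraph (Fin N)),
        N ≤ C * (Fintype.card V + W * Fintype.card E) ∧
        Nat.card G'.edgeSet ≤ C * (Fintype.card V + W * Fintype.card E) ∧
        (numPM G' : ℚ) = perfMatch ends (fun e => (w e : ℚ)) := by
  refine ⟨8, ?_⟩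
  intro V E _ _ ends w
  intro W
  obtain ⟨P, hlen, hP, hpm⟩ := start ends w
  change P.length ≤ W * Fintype.card E at hlen
  generalize W * Fintype.card E = K at *
  rw [hpm]
  rcases Nat.eq_zero_or_pos (Fintype.card V) with h0 | hpos
  · have hV : IsEmpty V := Fintype.card_eq_zero_iff.1 h0
    have hP0 : P = [] := by
      rw [List.eq_nil_iff_forall_not_mem]
      intro e he
      obtain ⟨hs, u, v, rfl⟩ := hP e he
      have := hs (show u ∈ _ by simp)
      simp [h0] at this
    refine ⟨0, listGraph 0 [], by simp, (listGraph_edges 0 []).trans (by simp), ?_⟩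
    rw [listGraph_numPM 0 [] (by simp) (by simp) (by simp), hP0, h0]
  · obtain ⟨N, D, b1, b2, b3, b4, b5, b6⟩ := process P (Fintype.card V + 1) (Fintype.card V) []
      (by omega) (fun e he => ⟨(hP e he).1.trans (Finset.range_mono (by omega)), (hP e he).2⟩)
      (by simp) (by simp) (by simp)
    simp only [List.length_nil, List.append_nil] at b2 b6
    refine ⟨N, listGraph N D, by omega, (listGraph_edges N D).trans (by omega), ?_⟩
    rw [listGraph_numPM N D b3 b4 b5, b6, gadget_init P _ (fun e he => (hP e he).1)]
end
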